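/- Let V be a finite set of N cells, let x : V → [0,1] assign occupancy values, let ε ∈ [0,1] and a > 0, and define the cell cost c(p) = x(p) + a if x(p) ≤ ε and c(p) = N(ε + a) otherwise. Then: (i) any path π visiting pairwise distinct cells, all of which satisfy x(p) ≤ ε (an ε-feasible simple path), has total cost Σ_{p∈π} c(p) ≤ N(ε + a); and (ii) any path π' containing at least two cells, at least one of which satisfies x(p) > ε, has total cost Σ_{p∈π'} c(p) > N(ε + a). Consequently, if an ε-feasible simple path from start to goal exists, every cost-minimizing path with at least two cells is ε-feasible. -/

import Mathlib

/-- Properties of the cell traversal cost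
`c(p) = x(p) + a` if `x(p) ≤ ε`, and `c(p) = N(ε + a)` otherwise:
(i) an ε-feasible simple path has total cost at most `N(ε + a)`;
(ii) a path with at least two cells containing an infeasible cell has total
cost strictly greater than `N(ε + a)`;
(iii) consequently, if an ε-feasible simple path from the start `s` to the goal
`g` exists, then every cost-minimizing path from `s` to `g` with at least two
cells is ε-feasible. -/
theorem stmt7 {V : Type*} [Fintype V] (N : ℕ) (hN : Fintype.card V = N)
    (x : V → ℝ) (hx : ∀ p, 0 ≤ x p ∧ x p ≤ 1)
    (ε a : ℝ) (hε : 0 ≤ ε ∧ ε ≤ 1) (ha : 0 < a)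
    (c : V → ℝ)
    (hc : ∀ p, c p = if x p ≤ ε then x p + a else (N : ℝ) * (ε + a)) :
    (∀ π : List V, π.Nodup → (∀ p ∈ π, x p ≤ ε) →
        (π.map c).sum ≤ (N : ℝ) * (ε + a)) ∧
    (∀ π' : List V, 2 ≤ π'.length → (∃ p ∈ π', ε < x p) →
        (N : ℝ) * (ε + a) < (π'.map c).sum) ∧
    (∀ s g : V,
      (∃ π₀ : List V, π₀.head? = some s ∧ π₀.getLast? = some g ∧ π₀.Nodup ∧
          ∀ p ∈ π₀, x p ≤ ε) →
      ∀ π : List V, π.head? = some s → π.getLast? = some g → 2 ≤ π.length →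
        (∀ π'' : List V, π''.head? = some s → π''.getLast? = some g →
            (π.map c).sum ≤ (π''.map c).sum) →
        ∀ p ∈ π, x p ≤ ε) := by
  have hea : 0 < ε + a := by linarith [hε.1]
  have hpos : ∀ p, 0 < c p := by
    intro p
    rw [hc]
    split_ifs
    · linarith [(hx p).1]
    · have : 0 < N := by
        rw [← hN]
        exact Fintype.card_pos_iff.mpr ⟨p⟩
      positivity
  have h1 : ∀ π : List V, π.Nodup → (∀ p ∈ π, x p ≤ ε) →
      (π.map c).sum ≤ (N : ℝ) * (ε + a) := by
    intro π hnd hf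
    have hle : (π.map c).sum ≤ (π.map c).length • (ε + a) := by
      apply List.sum_le_card_nsmul
      intro y hy
      obtain ⟨p, hp, rfl⟩ := List.mem_map.mp hy
      rw [hc, if_pos (hf p hp)]
      linarith [hf p hp]
    rw [List.length_map, nsmul_eq_mul] at hle
    have hlen : π.length ≤ N := hN ▸ hnd.length_le_card
    have hlen' : (π.length : ℝ) ≤ N := by exact_mod_cast hlen
    exact hle.trans (mul_le_mul_of_nonneg_right hlen' hea.le)
  have hnn : ∀ l : List V, 0 ≤ (l.map c).sum := by
    intro l
    apply List.sum_nonneg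
    intro y hy
    obtain ⟨p, hp, rfl⟩ := List.mem_map.mp hy
    exact (hpos p).le
  have hps : ∀ l : List V, l ≠ [] → 0 < (l.map c).sum := by
    intro l hl
    cases l with
    | nil => exact absurd rfl hl
    | cons b t =>
      simp only [List.map_cons, List.sum_cons]
      linarith [hpos b, hnn t]
  have h2 : ∀ π' : List V, 2 ≤ π'.length → (∃ p ∈ π', ε < x p) →
      (N : ℝ) * (ε + a) < (π'.map c).sum := by
    rintro π' hlen ⟨p, hp, hxp⟩
    obtain ⟨l1, l2, rfl⟩ := List.append_of_mem hp
    have hcp : c p = (N : ℝ) * (ε + a) := by rw [hc, if_neg (not_le.mpr hxp)]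
    simp only [List.map_append, List.map_cons, List.sum_append, List.sum_cons, hcp]
    by_cases h : l1 = []
    · have : l2 ≠ [] := by
        rintro rfl
        simp [h] at hlen
      linarith [hnn l1, hps l2 this]
    · linarith [hnn l2, hps l1 h]
  refine ⟨h1, h2, ?_⟩
  rintro s g ⟨π₀, hs, hg, hnd, hf⟩ π _ _ hlen hmin p hp
  by_contra hlt
  have := h2 π hlen ⟨p, hp, not_le.mp hlt⟩
  linarith [h1 π₀ hnd hf, hmin π₀ hs hg]
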